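/- arXiv:0903.4495 — 3 statements merged into one kernel-verified Lean document; each statement's English description precedes it below -/
import Mathlib

section
/- For every integer p and all natural numbers q, r, the determinant b(p,q,r) is given by the closed formula b(p,q,r) = 3p²·r + 3p²·q + 6p² − 2p. -/
/-- Entry function for the matrix `B(p,q,r)` from the paper. -/
def Bent (p : ℤ) (q r : ℕ) (i j : ℕ) : ℤ :=
  if i = 0 ∧ j = 0 then -2 * p
  else if i = j ∧ (i = 1 ∨ i = 2) then 1 - 2 * p
  else if i ≤ 2 ∧ j ≤ 2 then p
  else if 3 ≤ i ∧ i = j then 2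
  else if 3 ≤ min i j ∧ max i j ≤ 2 + q ∧ max i j = min i j + 1 then -1
  else if 3 + q ≤ min i j ∧ max i j ≤ 2 + q + r ∧ max i j = min i j + 1 then -1
  else if 1 ≤ q ∧ ((i = 2 ∧ j = 3) ∨ (i = 3 ∧ j = 2)) then -1
  else if 1 ≤ r ∧ ((i = 1 ∧ j = 3 + q) ∨ (i = 3 + q ∧ j = 1)) then -1
  else 0

/-- The matrix `B(p,q,r)`: a symmetric `(3+q+r) × (3+q+r)` integer matrix. -/
def Bmat (p : ℤ) (q r : ℕ) : Matrix (Fin (3 + q + r)) (Fin (3 + q + r)) ℤ :=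
  fun i j => Bent p q r i.val j.val

/-- `b(p,q,r) = det B(p,q,r)`. -/
def bdet (p : ℤ) (q r : ℕ) : ℤ := (Bmat p q r).det

/-- Expansion of a determinant along a last row and column with at most two nonzero entries each. -/
theorem Matrix.det_eq_of_last_tridiagonal {R : Type*} [CommRing R] {n : ℕ}
    (M : Matrix (Fin (n + 2)) (Fin (n + 2)) R)
    (hrow : ∀ i : Fin n, M (Fin.last _) i.castSucc.castSucc = 0)
    (hcol : ∀ i : Fin n, M i.castSucc.castSucc (Fin.last _) = 0) :
    M.det = M (Fin.last _) (Fin.last _) * (M.submatrix Fin.castSucc Fin.castSucc).det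
      - M (Fin.last _) (Fin.last n).castSucc * M (Fin.last n).castSucc (Fin.last _) *
        (M.submatrix (fun i : Fin n => i.castSucc.castSucc)
          (fun i : Fin n => i.castSucc.castSucc)).det := by
  have hminor : (M.submatrix Fin.castSucc (Fin.last n).castSucc.succAbove).det =
      M (Fin.last n).castSucc (Fin.last _) *
        (M.submatrix (fun i : Fin n => i.castSucc.castSucc)
          (fun i : Fin n => i.castSucc.castSucc)).det := by
    have hcols : ∀ i : Fin n, (Fin.last n).castSucc.succAbove i.castSucc = i.castSucc.castSucc :=
      fun i => Fin.succAbove_of_castSucc_lt _ _ (by simp [Fin.lt_def])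
    have hlast : (Fin.last n).castSucc.succAbove (Fin.last n) = Fin.last (n + 1) := by
      rw [Fin.succAbove_of_le_castSucc _ _ le_rfl, Fin.succ_last]
    rw [Matrix.det_succ_column _ (Fin.last n), Fin.sum_univ_castSucc]
    simp [hlast, hcol, hcols, Matrix.submatrix_submatrix, Function.comp_def, ← two_mul, pow_mul]
  rw [Matrix.det_succ_row _ (Fin.last (n + 1)), Fin.sum_univ_castSucc, Fin.sum_univ_castSucc]
  simp only [Fin.succAbove_last, hrow, hminor, Fin.val_last, Fin.val_castSucc, mul_zero, zero_mul,
    Finset.sum_const_zero, zero_add]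
  rw [show n + 1 + n = 2 * n + 1 by ring, show n + 1 + (n + 1) = 2 * (n + 1) by ring]
  simp only [pow_add, pow_mul]
  simp
  ring

theorem Bent_eq_of_le (p : ℤ) {q r s i j : ℕ} (hrs : r ≤ s) (hi : i < 3 + q + r)
    (hj : j < 3 + q + r) : Bent p q s i j = Bent p q r i j := by
  unfold Bent
  grind (splits := 20)

theorem bdet_add_two (p : ℤ) (q r : ℕ) :
    bdet p q (r + 2) = 2 * bdet p q (r + 1) - bdet p q r := by
  have h := Matrix.det_eq_of_last_tridiagonal (n := 3 + q + r) (Bmat p q (r + 2))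
    (fun i => by
      have := i.isLt
      simp only [Bmat, Bent, Fin.val_last, Fin.val_castSucc]
      grind)
    (fun i => by
      have := i.isLt
      simp only [Bmat, Bent, Fin.val_last, Fin.val_castSucc]
      grind)
  have hdiag : Bmat p q (r + 2) (Fin.last (3 + q + r + 1)) (Fin.last (3 + q + r + 1)) = 2 := by
    simp only [Bmat, Bent, Fin.val_last]
    grind
  have hleft : Bmat p q (r + 2) (Fin.last (3 + q + r + 1)) (Fin.last (3 + q + r)).castSucc
      = -1 := by
    simp only [Bmat, Bent, Fin.val_last, Fin.val_castSucc]
    grind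
  have hup : Bmat p q (r + 2) (Fin.last (3 + q + r)).castSucc (Fin.last (3 + q + r + 1))
      = -1 := by
    simp only [Bmat, Bent, Fin.val_last, Fin.val_castSucc]
    grind
  have hone : (Bmat p q (r + 2)).submatrix (Fin.castSucc (n := 3 + q + r + 1)) Fin.castSucc
      = Bmat p q (r + 1) := by
    ext i j
    exact Bent_eq_of_le p (by lia) i.isLt j.isLt
  have htwo : (Bmat p q (r + 2)).submatrix (fun i : Fin (3 + q + r) => i.castSucc.castSucc)
      (fun i : Fin (3 + q + r) => i.castSucc.castSucc) = Bmat p q r := by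
    ext i j
    exact Bent_eq_of_le p (by lia) i.isLt j.isLt
  rw [hdiag, hleft, hup, hone, htwo] at h
  unfold bdet
  linear_combination h

/-- The index map exchanging the two chains, together with their attaching vertices `1` and `2`. -/
def swapChains (q r i : ℕ) : ℕ :=
  if i = 0 then 0
  else if i = 1 then 2
  else if i = 2 then 1
  else if i < 3 + q then i + r
  else i - q

theorem swapChains_lt {q r i : ℕ} (hi : i < 3 + q + r) : swapChains q r i < 3 + r + q := by
  grind [swapChains]

theorem swapChains_swapChains {q r i : ℕ} (hi : i < 3 + q + r) :
    swapChains r q (swapChains q r i) = i := by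
  grind [swapChains]

theorem swapChains_cases (q r i : ℕ) :
    i = 0 ∧ swapChains q r i = 0 ∨ i = 1 ∧ swapChains q r i = 2 ∨ i = 2 ∧ swapChains q r i = 1 ∨
      3 ≤ i ∧ i < 3 + q ∧ swapChains q r i = i + r ∨
      3 ≤ swapChains q r i ∧ i = swapChains q r i + q := by
  unfold swapChains
  split_ifs <;> lia

theorem Bent_swapChains (p : ℤ) {q r i j : ℕ} (hi : i < 3 + q + r) (hj : j < 3 + q + r) :
    Bent p r q (swapChains q r i) (swapChains q r j) = Bent p q r i j := by
  have hi' := swapChains_cases q r i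
  have hj' := swapChains_cases q r j
  generalize swapChains q r i = k at *
  generalize swapChains q r j = l at *
  unfold Bent
  rcases hi' with ⟨rfl, rfl⟩ | ⟨rfl, rfl⟩ | ⟨rfl, rfl⟩ | ⟨_, _, rfl⟩ | ⟨_, rfl⟩ <;>
    rcases hj' with ⟨rfl, rfl⟩ | ⟨rfl, rfl⟩ | ⟨rfl, rfl⟩ | ⟨_, _, rfl⟩ | ⟨_, rfl⟩ <;>
    grind (splits := 20)

theorem bdet_comm (p : ℤ) (q r : ℕ) : bdet p q r = bdet p r q := by
  let e : Fin (3 + q + r) ≃ Fin (3 + r + q) :=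
    { toFun := fun i => ⟨swapChains q r i, swapChains_lt i.isLt⟩
      invFun := fun i => ⟨swapChains r q i, swapChains_lt i.isLt⟩
      left_inv := fun i => Fin.ext (swapChains_swapChains i.isLt)
      right_inv := fun i => Fin.ext (swapChains_swapChains i.isLt) }
  have h : (Bmat p r q).submatrix e e = Bmat p q r := by
    ext i j
    exact Bent_swapChains p i.isLt j.isLt
  rw [bdet, ← h, Matrix.det_submatrix_equiv_self, bdet]

theorem bdet_eq_of_zero_one (p : ℤ) (q r : ℕ) :
    bdet p q r = (1 - r) * bdet p q 0 + r * bdet p q 1 := by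
  induction r using Nat.twoStepInduction with
  | zero => simp
  | one => simp
  | more r ih ih' =>
    rw [bdet_add_two, ih, ih']
    push_cast
    ring

theorem bdet_zero_zero (p : ℤ) : bdet p 0 0 = 6 * p ^ 2 - 2 * p := by
  have h : Bmat p 0 0 = !![-2 * p, p, p; p, 1 - 2 * p, p; p, p, 1 - 2 * p] := by
    ext i j
    fin_cases i <;> fin_cases j <;> simp [Bmat, Bent]
  rw [bdet, h]
  simp [Matrix.det_fin_three]
  ring

theorem bdet_zero_one (p : ℤ) : bdet p 0 1 = 9 * p ^ 2 - 2 * p := by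
  have h : Bmat p 0 1 = !![-2 * p, p, p, 0; p, 1 - 2 * p, p, -1; p, p, 1 - 2 * p, 0;
      0, -1, 0, 2] := by
    ext i j
    fin_cases i <;> fin_cases j <;> simp [Bmat, Bent]
  rw [bdet, h]
  simp [Matrix.det_succ_row_zero, Fin.sum_univ_succ, Fin.succAbove]
  ring

theorem bdet_one_one (p : ℤ) : bdet p 1 1 = 12 * p ^ 2 - 2 * p := by
  have h : Bmat p 1 1 = !![-2 * p, p, p, 0, 0; p, 1 - 2 * p, p, 0, -1; p, p, 1 - 2 * p, -1, 0;
      0, 0, -1, 2, 0; 0, -1, 0, 0, 2] := by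
    ext i j
    fin_cases i <;> fin_cases j <;> simp [Bmat, Bent]
  rw [bdet, h]
  simp [Matrix.det_succ_row_zero, Fin.sum_univ_succ, Fin.succAbove]
  ring

theorem b_closed_formula (p : ℤ) (q r : ℕ) :
    bdet p q r = 3 * p ^ 2 * r + 3 * p ^ 2 * q + 6 * p ^ 2 - 2 * p := by
  rw [bdet_eq_of_zero_one, bdet_comm p q 0, bdet_comm p q 1, bdet_eq_of_zero_one p 0 q,
    bdet_eq_of_zero_one p 1 q, bdet_comm p 1 0, bdet_zero_zero, bdet_zero_one, bdet_one_one]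
  ring
end

section
/- For every integer p ≥ 1 and all natural numbers q, r, the determinant b(p,q,r) is strictly positive. -/
/-- The determinant of the leading `n × n` block of an infinite integer matrix. -/
def leadingDet (f : ℕ → ℕ → ℤ) (n : ℕ) : ℤ :=
  (Matrix.of fun i j : Fin n => f i j).det

/-- The strictly increasing enumeration of `ℕ \ {k}`. -/
def skip (k i : ℕ) : ℕ := if i < k then i else i + 1

theorem leadingDet_congr {f g : ℕ → ℕ → ℤ} {n : ℕ}
    (h : ∀ i < n, ∀ j < n, f i j = g i j) : leadingDet f n = leadingDet g n := by
  unfold leadingDet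
  congr 1
  ext i j
  exact h i i.isLt j j.isLt

theorem val_succAbove {n : ℕ} (k : Fin (n + 1)) (i : Fin n) :
    (k.succAbove i : ℕ) = skip k i := by
  simp only [Fin.succAbove, skip, Fin.lt_def, Fin.val_castSucc]
  split_ifs <;> simp

/-- Expansion of a determinant whose last index is a leaf attached to the index `k`. -/
theorem leadingDet_leaf (f : ℕ → ℕ → ℤ) (n k : ℕ) (hk : k < n + 1)
    (hd : f (n + 1) (n + 1) = 2)
    (hr : ∀ j < n + 1, f (n + 1) j = if j = k then -1 else 0)
    (hc : ∀ j < n + 1, f j (n + 1) = if j = k then -1 else 0) :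
    leadingDet f (n + 2) =
      2 * leadingDet f (n + 1) - leadingDet (fun i j => f (skip k i) (skip k j)) n := by
  have hminor : ((Matrix.of fun i j : Fin (n + 2) => f i j).submatrix
      (Fin.last (n + 1)).succAbove (Fin.castSucc ⟨k, hk⟩).succAbove).det =
      -((-1) ^ (k + n) * leadingDet (fun i j => f (skip k i) (skip k j)) n) := by
    have he : ((Fin.castSucc (⟨k, hk⟩ : Fin (n + 1))).succAbove (Fin.last n) : ℕ) = n + 1 := by
      rw [val_succAbove]
      simp only [skip, Fin.val_castSucc, Fin.val_last]
      split_ifs <;> omega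
    rw [Matrix.det_succ_column _ (Fin.last n), Finset.sum_eq_single (⟨k, hk⟩ : Fin (n + 1))]
    · have he : ((Fin.castSucc (⟨k, hk⟩ : Fin (n + 1))).succAbove (Fin.last n) : ℕ) = n + 1 := by
        rw [val_succAbove]
        simp only [skip, Fin.val_castSucc, Fin.val_last]
        split_ifs <;> omega
      simp only [Matrix.submatrix_apply, Matrix.of_apply, he, Fin.succAbove_last,
        Fin.val_castSucc, hc k hk, Fin.val_last, Matrix.submatrix_submatrix]
      have hs : (Matrix.of fun i j : Fin (n + 2) => f i j).submatrix
          (Fin.castSucc ∘ (⟨k, hk⟩ : Fin (n + 1)).succAbove)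
          ((Fin.castSucc (⟨k, hk⟩ : Fin (n + 1))).succAbove ∘ Fin.castSucc) =
          Matrix.of fun i j : Fin n => f (skip k i) (skip k j) := by
        ext i j
        simp [val_succAbove]
      rw [hs]
      simp [leadingDet]
    · intro i _ hi
      have hik : (i : ℕ) ≠ k := fun h => hi (Fin.ext h)
      simp only [Matrix.submatrix_apply, Matrix.of_apply, he, Fin.succAbove_last,
        Fin.val_castSucc, hc i i.isLt, if_neg hik, mul_zero, zero_mul]
    · simp
  have hsign : (-1 : ℤ) ^ (n + 1 + k) * (-1) ^ (k + n) = -1 := by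
    rw [← pow_add]
    exact Odd.neg_one_pow ⟨n + k, by ring⟩
  have hmain : (Matrix.of fun i j : Fin (n + 2) => f i j).submatrix
      (Fin.last (n + 1)).succAbove (Fin.last (n + 1)).succAbove =
      Matrix.of fun i j : Fin (n + 1) => f i j := by
    ext i j
    simp
  rw [leadingDet, Matrix.det_succ_row _ (Fin.last (n + 1)), Fin.sum_univ_castSucc,
    Finset.sum_eq_single (⟨k, hk⟩ : Fin (n + 1)), hminor, hmain]
  · simp only [Matrix.of_apply, Fin.val_last, Fin.val_castSucc, hd, hr k hk, if_true,
      Even.neg_one_pow ⟨n + 1, rfl⟩]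
    rw [← leadingDet]
    linear_combination (leadingDet (fun i j => f (skip k i) (skip k j)) n) * hsign
  · intro j _ hj
    have hjk : (j : ℕ) ≠ k := fun h => hj (Fin.ext h)
    simp [hr j j.isLt, hjk]
  · simp

/-- The three-term recurrence for extending a chain by one vertex. -/
theorem leadingDet_chain (f : ℕ → ℕ → ℤ) (n : ℕ)
    (hd : f (n + 1) (n + 1) = 2)
    (hr : ∀ j < n + 1, f (n + 1) j = if j = n then -1 else 0)
    (hc : ∀ j < n + 1, f j (n + 1) = if j = n then -1 else 0) :
    leadingDet f (n + 2) = 2 * leadingDet f (n + 1) - leadingDet f n := by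
  rw [leadingDet_leaf f n n (by omega) hd hr hc]
  congr 1
  exact leadingDet_congr fun i hi j hj => by simp [skip, hi, hj]

theorem Bent_succ_left (p : ℤ) {q i j : ℕ} (hi : i < 3 + q) (hj : j < 3 + q) :
    Bent p (q + 1) 0 i j = Bent p q 0 i j := by
  unfold Bent
  repeat refine if_congr (by omega) rfl ?_
  rfl

theorem Bent_succ_right (p : ℤ) {q r i j : ℕ} (hi : i < 3 + q + r) (hj : j < 3 + q + r) :
    Bent p q (r + 1) i j = Bent p q r i j := by
  unfold Bent
  repeat refine if_congr (by omega) rfl ?_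
  rfl

theorem Bent_comm (p : ℤ) (q r i j : ℕ) : Bent p q r i j = Bent p q r j i := by
  unfold Bent
  by_cases h : i = j
  · rw [h]
  · repeat refine if_congr (by omega) rfl ?_
    rfl

theorem Bent_diag (p : ℤ) (q r : ℕ) {i : ℕ} (hi : 3 ≤ i) : Bent p q r i i = 2 := by
  unfold Bent
  rw [if_neg (by omega), if_neg (by omega), if_neg (by omega), if_pos (by omega)]

theorem Bent_left_last (p : ℤ) (q : ℕ) {j : ℕ} (hj : j < 3 + q + 1) :
    Bent p (q + 2) 0 (3 + q + 1) j = if j = 3 + q then -1 else 0 := by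
  unfold Bent
  rw [if_neg (by omega), if_neg (by omega), if_neg (by omega), if_neg (by omega)]
  refine if_congr (by omega) rfl ?_
  rw [if_neg (by omega), if_neg (by omega), if_neg (by omega)]

theorem Bent_right_last (p : ℤ) (q r : ℕ) {j : ℕ} (hj : j < 3 + q + r + 1) :
    Bent p q (r + 2) (3 + q + r + 1) j = if j = 3 + q + r then -1 else 0 := by
  unfold Bent
  rw [if_neg (by omega), if_neg (by omega), if_neg (by omega), if_neg (by omega),
    if_neg (by omega)]
  refine if_congr (by omega) rfl ?_
  rw [if_neg (by omega), if_neg (by omega)]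

theorem Bent_right_single (p : ℤ) (q : ℕ) {j : ℕ} (hj : j < 3 + q) :
    Bent p q 1 (3 + q) j = if j = 1 then -1 else 0 := by
  unfold Bent
  rw [if_neg (by omega), if_neg (by omega), if_neg (by omega), if_neg (by omega),
    if_neg (by omega), if_neg (by omega), if_neg (by omega)]
  exact if_congr (by omega) rfl rfl

theorem skip_lt {k i n : ℕ} (hi : i < n) : skip k i < n + 1 := by
  unfold skip
  split_ifs <;> omega

theorem leadingDet_Bent_zero (p : ℤ) (q : ℕ) :
    leadingDet (Bent p q 0) (3 + q) = 3 * p ^ 2 * (q + 2) - 2 * p := by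
  induction q using Nat.twoStepInduction with
  | zero =>
    simp [leadingDet, Matrix.det_fin_three, Bent]
    ring
  | one =>
    simp [leadingDet, Matrix.det_succ_row_zero, Fin.sum_univ_succ, Bent, Fin.succAbove]
    ring
  | more q h0 h1 =>
    have h := leadingDet_chain (Bent p (q + 2) 0) (3 + q)
      (Bent_diag _ _ _ (by omega))
      (fun j hj => Bent_left_last p q hj)
      (fun j hj => (Bent_comm ..).trans (Bent_left_last p q hj))
    rw [leadingDet_congr (n := 3 + q + 1) fun i hi j hj =>
        Bent_succ_left p (q := q + 1) hi hj,
      leadingDet_congr (n := 3 + q) fun i hi j hj =>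
        (Bent_succ_left p (q := q + 1) (by omega) (by omega)).trans
          (Bent_succ_left p hi hj), h0] at h
    rw [← add_assoc] at h1 ⊢
    rw [h, h1]
    push_cast
    ring

theorem leadingDet_Bent_skip_one (p : ℤ) (q : ℕ) :
    leadingDet (fun i j => Bent p q 0 (skip 1 i) (skip 1 j)) (2 + q) =
      3 * p ^ 2 * (q + 1) - 2 * p := by
  induction q using Nat.twoStepInduction with
  | zero =>
    simp [leadingDet, Matrix.det_fin_two, Bent, skip]
    ring
  | one =>
    simp [leadingDet, Matrix.det_fin_three, Bent, skip]
    ring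
  | more q h0 h1 =>
    have hs {i n : ℕ} (hi : i < 2 + n) : skip 1 i < 3 + n := by
      have := skip_lt (k := 1) hi
      omega
    have hlast : skip 1 (2 + q + 1) = 3 + q + 1 := by
      rw [skip, if_neg (by omega)]
      omega
    have hrow (j : ℕ) (hj : j < 2 + q + 1) :
        Bent p (q + 2) 0 (skip 1 (2 + q + 1)) (skip 1 j) = if j = 2 + q then -1 else 0 := by
      rw [hlast, Bent_left_last p q (hs (n := q + 1) hj)]
      refine if_congr ?_ rfl rfl
      unfold skip
      split_ifs <;> omega
    have h := leadingDet_chain (fun i j => Bent p (q + 2) 0 (skip 1 i) (skip 1 j)) (2 + q)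
      (by rw [hlast]; exact Bent_diag _ _ _ (by omega))
      hrow
      (fun j hj => (Bent_comm ..).trans (hrow j hj))
    rw [leadingDet_congr (n := 2 + q + 1) fun i hi j hj =>
        Bent_succ_left p (q := q + 1) (hs hi) (hs hj),
      leadingDet_congr (n := 2 + q) fun i hi j hj =>
        (Bent_succ_left p (q := q + 1) (hs (by omega)) (hs (by omega))).trans
          (Bent_succ_left p (hs hi) (hs hj)), h0] at h
    rw [← add_assoc] at h1 ⊢
    rw [h, h1]
    push_cast
    ring

theorem leadingDet_Bent_one (p : ℤ) (q : ℕ) :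
    leadingDet (Bent p q 1) (3 + q + 1) = 3 * p ^ 2 * (q + 3) - 2 * p := by
  have hl : 2 + q + 1 = 3 + q := by omega
  have h := leadingDet_leaf (Bent p q 1) (2 + q) 1 (by omega)
    (Bent_diag _ _ _ (by omega))
    (fun j hj => hl ▸ Bent_right_single p q (hl ▸ hj))
    (fun j hj => (Bent_comm ..).trans (hl ▸ Bent_right_single p q (hl ▸ hj)))
  have hs {i : ℕ} (hi : i < 2 + q) : skip 1 i < 3 + q + 0 := by
    have := skip_lt (k := 1) hi
    omega
  rw [leadingDet_congr (n := 2 + q + 1) fun i hi j hj =>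
      Bent_succ_right p (r := 0) (by omega) (by omega),
    leadingDet_congr (n := 2 + q) fun i hi j hj => Bent_succ_right p (hs hi) (hs hj),
    leadingDet_Bent_skip_one, hl, leadingDet_Bent_zero] at h
  rw [show 3 + q + 1 = 2 + q + 2 by omega, h]
  ring

theorem bdet_eq (p : ℤ) (q r : ℕ) : bdet p q r = 3 * p ^ 2 * (q + r + 2) - 2 * p := by
  change leadingDet (Bent p q r) (3 + q + r) = _
  induction r using Nat.twoStepInduction with
  | zero => simpa using leadingDet_Bent_zero p q
  | one =>
    rw [leadingDet_Bent_one]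
    push_cast
    ring
  | more r h0 h1 =>
    have h := leadingDet_chain (Bent p q (r + 2)) (3 + q + r)
      (Bent_diag _ _ _ (by omega))
      (fun j hj => Bent_right_last p q r hj)
      (fun j hj => (Bent_comm ..).trans (Bent_right_last p q r hj))
    rw [leadingDet_congr (n := 3 + q + r + 1) fun i hi j hj =>
        Bent_succ_right p (r := r + 1) hi hj,
      leadingDet_congr (n := 3 + q + r) fun i hi j hj =>
        (Bent_succ_right p (r := r + 1) (by omega) (by omega)).trans
          (Bent_succ_right p hi hj), h0] at h
    rw [← add_assoc] at h1 ⊢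
    rw [h, h1]
    push_cast
    ring

theorem b_positive (p : ℤ) (hp : 1 ≤ p) (q r : ℕ) :
    0 < bdet p q r := by
  rw [bdet_eq]
  have hq : (0 : ℤ) ≤ p ^ 2 * (q + r) := by positivity
  nlinarith
end

section
/- For every integer p ≥ 2 and all natural numbers q, r, the determinant c(p,q,r) is strictly positive. -/
/-- Entry function for the matrix `C(p,q,r)` from the paper. -/
def Cent (p : ℤ) (q r : ℕ) (i j : ℕ) : ℤ :=
  if i = j ∧ i ≤ 1 then 1 - 2 * p
  else if i ≤ 1 ∧ j ≤ 1 then p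
  else if 2 ≤ i ∧ i = j then 2
  else if 2 ≤ min i j ∧ max i j ≤ 1 + q ∧ max i j = min i j + 1 then -1
  else if 2 + q ≤ min i j ∧ max i j ≤ 1 + q + r ∧ max i j = min i j + 1 then -1
  else if 1 ≤ q ∧ ((i = 1 ∧ j = 2) ∨ (i = 2 ∧ j = 1)) then -1
  else if 1 ≤ r ∧ ((i = 0 ∧ j = 2 + q) ∨ (i = 2 + q ∧ j = 0)) then -1
  else 0

/-- The matrix `C(p,q,r)`: a symmetric `(2+q+r) × (2+q+r)` integer matrix. -/
def Cmat (p : ℤ) (q r : ℕ) : Matrix (Fin (2 + q + r)) (Fin (2 + q + r)) ℤ :=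
  fun i j => Cent p q r i.val j.val

/-- `c(p,q,r) = det C(p,q,r)`. -/
def cdet (p : ℤ) (q r : ℕ) : ℤ := (Cmat p q r).det

/-- The leading principal minor of order `n` of an infinite matrix. -/
def leadingMinor (A : ℕ → ℕ → ℤ) (n : ℕ) : ℤ :=
  (Matrix.of fun i j : Fin n => A i j).det

/-- The three-term recurrence for the leading principal minors of a tridiagonal matrix. -/
theorem leadingMinor_add_two (A : ℕ → ℕ → ℤ) (n : ℕ)
    (h_row : ∀ j < n, A (n + 1) j = 0) (h_col : ∀ i < n, A i (n + 1) = 0) :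
    leadingMinor A (n + 2) =
      A (n + 1) (n + 1) * leadingMinor A (n + 1) -
        A (n + 1) n * A n (n + 1) * leadingMinor A n := by
  have h_minor : ((Matrix.of fun i j : Fin (n + 2) => A i j).submatrix Fin.castSucc
      (Fin.last n).castSucc.succAbove).det = A n (n + 1) * leadingMinor A n := by
    rw [Matrix.det_succ_column _ (Fin.last n), Fin.sum_univ_castSucc, Finset.sum_eq_zero]
    · have h_sub : (((Matrix.of fun i j : Fin (n + 2) => A i j).submatrix Fin.castSucc
          (Fin.last n).castSucc.succAbove).submatrix (Fin.last n).succAbove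
          (Fin.last n).succAbove) = Matrix.of fun i j : Fin n => A i j := by
        ext i j
        simp [Fin.succAbove, Fin.lt_def]
      rw [h_sub]
      simp [leadingMinor, ← two_mul]
    · intro i _
      simp [h_col i i.isLt]
  rw [leadingMinor, Matrix.det_succ_row _ (Fin.last (n + 1)), Fin.sum_univ_castSucc,
    Fin.sum_univ_castSucc, Finset.sum_eq_zero]
  · rw [Fin.succAbove_last, h_minor]
    have h_sub : (Matrix.of fun i j : Fin (n + 2) => A i j).submatrix Fin.castSucc Fin.castSucc =
        Matrix.of fun i j : Fin (n + 1) => A i j := by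
      ext i j
      simp
    rw [h_sub]
    have h_odd : (-1 : ℤ) ^ (n + 1 + n) = -1 := Odd.neg_one_pow ⟨n, by ring⟩
    simp [leadingMinor, h_odd, ← two_mul]
    ring
  · intro j _
    simp [h_row j j.isLt]

/-- The reversal of the initial segment `{0, …, q + 1}`, which turns the indexing of `Cmat p q r`
into the order in which its nonzero entries form a path. -/
def pathIndex (q t : ℕ) : ℕ := if t ≤ q + 1 then q + 1 - t else t

theorem cdet_eq_leadingMinor (p : ℤ) (q r : ℕ) :
    cdet p q r =
      leadingMinor (fun i j => Cent p q r (pathIndex q i) (pathIndex q j)) (2 + q + r) := by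
  have h_lt (t : Fin (2 + q + r)) : pathIndex q t < 2 + q + r := by
    unfold pathIndex
    split <;> omega
  have h_inv : Function.Involutive
      (fun t : Fin (2 + q + r) => (⟨pathIndex q t, h_lt t⟩ : Fin (2 + q + r))) := by
    intro t
    ext
    simp only [pathIndex]
    split_ifs <;> omega
  exact (Matrix.det_submatrix_equiv_self h_inv.toPerm (Cmat p q r)).symm

theorem c_positive (p : ℤ) (hp : 2 ≤ p) (q r : ℕ) :
    0 < cdet p q r := by
  rw [cdet_eq_leadingMinor]
  set A : ℕ → ℕ → ℤ := fun i j => Cent p q r (pathIndex q i) (pathIndex q j) with hA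
  have h_row (n : ℕ) : ∀ j < n, A (n + 1) j = 0 := by
    intro j hj
    simp only [hA, Cent, pathIndex]
    grind
  have h_col (n : ℕ) : ∀ i < n, A i (n + 1) = 0 := by
    intro i hi
    simp only [hA, Cent, pathIndex]
    grind
  have h_rec (n : ℕ) := leadingMinor_add_two A n (h_row n) (h_col n)
  have h_diag (n : ℕ) (hn : n ≠ q) (hn' : n ≠ q + 1) : A n n = 2 := by
    simp only [hA, Cent, pathIndex]
    grind
  have h_diag_left : A q q = 1 - 2 * p := by
    simp only [hA, Cent, pathIndex]
    grind
  have h_diag_right : A (q + 1) (q + 1) = 1 - 2 * p := by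
    simp only [hA, Cent, pathIndex]
    grind
  have h_mid : A (q + 1) q * A q (q + 1) = p * p := by
    simp only [hA, Cent, pathIndex]
    grind
  have h_off (n : ℕ) (hn : n ≠ q) (hn' : n < 1 + q + r) : A (n + 1) n * A n (n + 1) = 1 := by
    have h_down : A (n + 1) n = -1 := by
      simp only [hA, Cent, pathIndex]
      grind
    have h_up : A n (n + 1) = -1 := by
      simp only [hA, Cent, pathIndex]
      grind
    rw [h_down, h_up]
    norm_num
  have h_zero : leadingMinor A 0 = 1 := by simp [leadingMinor]
  have h_one : leadingMinor A 1 = A 0 0 := by simp [leadingMinor]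
  have h_chain (n : ℕ) : (n ≤ q → leadingMinor A n = n + 1) ∧
      (n + 1 ≤ q → leadingMinor A (n + 1) = n + 2) := by
    induction n with
    | zero =>
      refine ⟨fun _ => by simp [h_zero], fun h => ?_⟩
      rw [h_one, h_diag 0 (by omega) (by omega)]
      norm_num
    | succ n ih =>
      refine ⟨fun h => by rw [ih.2 h]; push_cast; ring, fun h => ?_⟩
      rw [h_rec, h_diag _ (by omega) (by omega), h_off _ (by omega) (by omega),
        ih.1 (by omega), ih.2 (by omega)]
      push_cast
      ring
  have h_left : leadingMinor A (q + 1) = (1 - 2 * p) * (q + 1) - q := by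
    rcases q with _ | m
    · rw [h_one, h_diag_left]
      simp
    · rw [h_rec, h_diag_left, h_off _ (by omega) (by omega), (h_chain m).1 (by omega),
        (h_chain m).2 le_rfl]
      push_cast
      ring
  have h_right : leadingMinor A (q + 2) =
      (1 - 2 * p) * ((1 - 2 * p) * (q + 1) - q) - p * p * (q + 1) := by
    rw [h_rec, h_diag_right, h_mid, h_left, (h_chain q).1 le_rfl]
  have h_neg : leadingMinor A (q + 1) < 0 := by
    rw [h_left]
    nlinarith
  have h_pos : 0 < leadingMinor A (q + 2) := by
    rw [h_right]
    have hq : (0 : ℤ) ≤ q := Int.natCast_nonneg q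
    have h_sq : 0 < (2 * p - 1) * (2 * p - 1) - p * p := by nlinarith
    nlinarith [mul_nonneg hq h_sq.le, mul_nonneg hq (by linarith : 0 ≤ 2 * p - 1)]
  have h_tail (s : ℕ) : s ≤ r → 0 < leadingMinor A (q + 2 + s) ∧
      leadingMinor A (q + 1 + s) < leadingMinor A (q + 2 + s) := by
    induction s with
    | zero => exact fun _ => ⟨h_pos, h_neg.trans h_pos⟩
    | succ s ih =>
      intro h
      obtain ⟨h_ih_pos, h_ih_lt⟩ := ih (by omega)
      have h_step := h_rec (q + 1 + s)
      rw [h_diag _ (by omega) (by omega), h_off _ (by omega) (by omega),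
        show q + 1 + s + 2 = q + 2 + (s + 1) by ring,
        show q + 1 + s + 1 = q + 2 + s by ring] at h_step
      rw [show q + 1 + (s + 1) = q + 2 + s by ring]
      constructor <;> linarith
  rw [show 2 + q + r = q + 2 + r by ring]
  exact (h_tail r le_rfl).1
end
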